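/- arXiv:2307.01828 — 2 statements merged into one kernel-verified Lean document; each statement's English description precedes it below -/
import Mathlib

section
/- For every K > 0 there exists t₀ ∈ (0,1) such that for all t ∈ (0, t₀] the following holds: if φ : ℝ² → ℝ is differentiable on the open annulus A_t = {x ∈ ℝ² : t² < ‖x‖ < t} with |φ(x)| ≤ K and ‖∇φ(x)‖ ≤ K for all x ∈ A_t, then the product φ·η_t satisfies ∫_{A_t} ‖∇(φ·η_t)(x)‖² dx ≤ 5πK²/|log t|. -/
open MeasureTheory

/-- The open annulus `{x : t² < ‖x‖ < t}` in the Euclidean plane. -/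
def logAnnulus (t : ℝ) : Set (EuclideanSpace ℝ (Fin 2)) :=
  {x | t ^ 2 < ‖x‖ ∧ ‖x‖ < t}

/-- The logarithmic cutoff function `η_t(x) = (2 log t − log ‖x‖)/log t`. -/
noncomputable def logCutoff (t : ℝ) (x : EuclideanSpace ℝ (Fin 2)) : ℝ :=
  (2 * Real.log t - Real.log ‖x‖) / Real.log t

lemma measurableSet_logAnnulus (t : ℝ) : MeasurableSet (logAnnulus t) :=
  (measurableSet_lt measurable_const measurable_norm).inter
    (measurableSet_lt measurable_norm measurable_const)

lemma volume_logAnnulus_lt_top (t : ℝ) : volume (logAnnulus t) < ⊤ :=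
  (measure_mono (fun x hx => by simpa using hx.2)).trans_lt
    (measure_ball_lt_top (x := (0 : EuclideanSpace ℝ (Fin 2))) (r := t))

/-- Integration of a radial function over an annulus in polar coordinates. -/
lemma setIntegral_logAnnulus_norm (f : ℝ → ℝ) {t : ℝ} (h : t ^ 2 ≤ t) :
    ∫ x in logAnnulus t, f ‖x‖ = 2 * Real.pi * ∫ r in t ^ 2..t, r * f r := by
  have hind : ∀ x : EuclideanSpace ℝ (Fin 2),
      (logAnnulus t).indicator (fun x => f ‖x‖) x =
        (Set.Ioo (t ^ 2) t).indicator f ‖x‖ := fun x => rfl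
  have hball : volume.real (Metric.ball (0 : EuclideanSpace ℝ (Fin 2)) 1) = Real.pi := by
    simp [Measure.real, Real.pi_nonneg]
  rw [← integral_indicator (measurableSet_logAnnulus t), integral_congr_ae (ae_of_all _ hind),
    integral_fun_norm_addHaar volume ((Set.Ioo (t ^ 2) t).indicator f), hball,
    intervalIntegral.integral_of_le h, integral_Ioc_eq_integral_Ioo]
  have hmul : ∀ r : ℝ,
      r ^ (Module.finrank ℝ (EuclideanSpace ℝ (Fin 2)) - 1) • (Set.Ioo (t ^ 2) t).indicator f r =
        (Set.Ioo (t ^ 2) t).indicator (fun r => r * f r) r := by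
    intro r
    by_cases hr : r ∈ Set.Ioo (t ^ 2) t <;> simp [hr]
  have hsub : Set.Ioo (t ^ 2) t ⊆ Set.Ioi 0 := fun r hr => (sq_nonneg t).trans_lt hr.1
  simp_rw [hmul]
  rw [setIntegral_indicator measurableSet_Ioo, Set.inter_eq_right.2 hsub]
  simp [mul_assoc]

lemma setIntegral_logAnnulus_const_add_div_sq (a b : ℝ) {t : ℝ} (ht0 : 0 < t) (ht1 : t < 1) :
    ∫ x in logAnnulus t, (a + b / ‖x‖ ^ 2) =
      2 * Real.pi * (a * (t ^ 2 - t ^ 4) / 2 - b * Real.log t) := by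
  have hle : t ^ 2 ≤ t := by nlinarith
  have ht2 : 0 < t ^ 2 := by positivity
  have hpos : ∀ r ∈ Set.uIcc (t ^ 2) t, r ≠ 0 := fun r hr =>
    (ht2.trans_le (Set.uIcc_of_le hle ▸ hr).1).ne'
  rw [setIntegral_logAnnulus_norm (fun r => a + b / r ^ 2) hle]
  have hcongr : ∫ r in t ^ 2..t, r * (a + b / r ^ 2) = ∫ r in t ^ 2..t, (a * r + b * r⁻¹) := by
    refine intervalIntegral.integral_congr fun r hr => ?_
    have := hpos r hr
    field_simp
  rw [hcongr, intervalIntegral.integral_add, intervalIntegral.integral_const_mul,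
    intervalIntegral.integral_const_mul, integral_id, integral_inv_of_pos ht2 ht0,
    Real.log_div ht0.ne' ht2.ne', Real.log_pow]
  · push_cast
    ring
  · exact (continuous_const.mul continuous_id).intervalIntegrable _ _
  · exact (intervalIntegral.intervalIntegrable_inv hpos continuousOn_id).const_mul b

lemma integrableOn_logAnnulus_const_add_div_sq (a b : ℝ) {t : ℝ} (ht0 : 0 < t) :
    IntegrableOn (fun x => a + b / ‖x‖ ^ 2) (logAnnulus t) := by
  have hmeas : Measurable fun x : EuclideanSpace ℝ (Fin 2) => a + b / ‖x‖ ^ 2 := by fun_prop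
  refine IntegrableOn.of_bound (volume_logAnnulus_lt_top t) hmeas.aestronglyMeasurable
    (|a| + |b| / (t ^ 2) ^ 2) ?_
  refine (ae_restrict_mem (measurableSet_logAnnulus t)).mono fun x hx => ?_
  have hx1 : t ^ 2 < ‖x‖ := hx.1
  calc ‖a + b / ‖x‖ ^ 2‖ ≤ |a| + |b| / ‖x‖ ^ 2 := by
        refine (norm_add_le _ _).trans_eq ?_
        simp [Real.norm_eq_abs]
    _ ≤ |a| + |b| / (t ^ 2) ^ 2 := by gcongr

lemma norm_gradient {F : Type*} [NormedAddCommGroup F] [InnerProductSpace ℝ F] [CompleteSpace F]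
    (f : F → ℝ) (x : F) : ‖gradient f x‖ = ‖fderiv ℝ f x‖ :=
  LinearIsometryEquiv.norm_map _ _

lemma hasFDerivAt_logCutoff (t : ℝ) {x : EuclideanSpace ℝ (Fin 2)} (hx : x ≠ 0) :
    HasFDerivAt (logCutoff t)
      (-((Real.log t)⁻¹ • ‖x‖⁻¹ • fderiv ℝ (fun y : EuclideanSpace ℝ (Fin 2) => ‖y‖) x)) x := by
  have hnorm := ((differentiableAt_id (𝕜 := ℝ) (x := x)).norm ℝ hx).hasFDerivAt
  have hlog := ((hnorm.log (norm_ne_zero_iff.2 hx)).const_sub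
    (2 * Real.log t)).const_mul (Real.log t)⁻¹
  refine (hlog.congr_of_eventuallyEq (.of_forall fun y => ?_)).congr_fderiv ?_
  · simp [logCutoff, div_eq_inv_mul]
  · simp

lemma norm_fderiv_logCutoff_le (t : ℝ) {x : EuclideanSpace ℝ (Fin 2)} (hx : x ≠ 0) :
    ‖fderiv ℝ (logCutoff t) x‖ ≤ |Real.log t|⁻¹ * ‖x‖⁻¹ := by
  rw [(hasFDerivAt_logCutoff t hx).fderiv, norm_neg, norm_smul, norm_smul, norm_inv, norm_inv,
    norm_norm, Real.norm_eq_abs]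
  have h : ‖fderiv ℝ (fun y : EuclideanSpace ℝ (Fin 2) => ‖y‖) x‖ ≤ 1 := by
    simpa using norm_fderiv_le_of_lipschitz ℝ (x₀ := x) lipschitzWith_one_norm
  gcongr
  exact mul_le_of_le_one_right (by positivity) h

lemma abs_logCutoff_le_one {t : ℝ} (ht0 : 0 < t) (ht1 : t < 1) {x : EuclideanSpace ℝ (Fin 2)}
    (hx : x ∈ logAnnulus t) : |logCutoff t x| ≤ 1 := by
  have hlog : Real.log t < 0 := Real.log_neg ht0 ht1
  have hx0 : 0 < ‖x‖ := (by positivity : 0 < t ^ 2).trans hx.1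
  have h1 : 2 * Real.log t < Real.log ‖x‖ := by
    simpa using Real.log_lt_log (by positivity) hx.1
  have h2 : Real.log ‖x‖ < Real.log t := Real.log_lt_log hx0 hx.2
  rw [logCutoff, abs_div, div_le_one (abs_pos.2 hlog.ne), abs_of_neg hlog, abs_of_neg] <;> linarith

lemma norm_gradient_mul_logCutoff_sq_le {K t : ℝ} (hK : 0 < K) (ht0 : 0 < t) (ht1 : t < 1)
    {φ : EuclideanSpace ℝ (Fin 2) → ℝ} {x : EuclideanSpace ℝ (Fin 2)} (hx : x ∈ logAnnulus t)
    (hφ : DifferentiableAt ℝ φ x) (hφK : |φ x| ≤ K) (hgrad : ‖gradient φ x‖ ≤ K) :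
    ‖gradient (fun y => φ y * logCutoff t y) x‖ ^ 2 ≤
      2 * K ^ 2 + 2 * K ^ 2 / Real.log t ^ 2 / ‖x‖ ^ 2 := by
  have hx0 : x ≠ 0 := norm_pos_iff.1 ((by positivity : 0 < t ^ 2).trans hx.1)
  rw [norm_gradient] at hgrad ⊢
  rw [fderiv_fun_mul hφ (hasFDerivAt_logCutoff t hx0).differentiableAt]
  have hbound : ‖φ x • fderiv ℝ (logCutoff t) x + logCutoff t x • fderiv ℝ φ x‖ ≤
      K * (|Real.log t|⁻¹ * ‖x‖⁻¹) + 1 * K := by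
    refine (norm_add_le _ _).trans ?_
    rw [norm_smul, norm_smul, Real.norm_eq_abs, Real.norm_eq_abs]
    gcongr
    · exact norm_fderiv_logCutoff_le t hx0
    · exact abs_logCutoff_le_one ht0 ht1 hx
  calc _ ≤ (K * (|Real.log t|⁻¹ * ‖x‖⁻¹) + 1 * K) ^ 2 := by gcongr
    _ ≤ 2 * ((K * (|Real.log t|⁻¹ * ‖x‖⁻¹)) ^ 2 + (1 * K) ^ 2) := add_sq_le
    _ = _ := by
      rw [mul_pow, mul_pow, inv_pow, sq_abs]
      ring

theorem dirichlet_energy_product_cutoff (K : ℝ) (hK : 0 < K) :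
    ∃ t₀ ∈ Set.Ioo (0 : ℝ) 1, ∀ t ∈ Set.Ioc (0 : ℝ) t₀,
      ∀ φ : EuclideanSpace ℝ (Fin 2) → ℝ,
        (∀ x ∈ logAnnulus t,
          DifferentiableAt ℝ φ x ∧ |φ x| ≤ K ∧ ‖gradient φ x‖ ≤ K) →
        ∫ x in logAnnulus t,
            ‖gradient (fun y => φ y * logCutoff t y) x‖ ^ 2 ∂volume ≤
          5 * Real.pi * K ^ 2 / |Real.log t| := by
  refine ⟨1 / 2, by norm_num, fun t ⟨ht0, ht⟩ φ hφ => ?_⟩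
  have ht1 : t < 1 := by linarith
  have hmono : ∫ x in logAnnulus t, ‖gradient (fun y => φ y * logCutoff t y) x‖ ^ 2 ≤
      ∫ x in logAnnulus t, (2 * K ^ 2 + 2 * K ^ 2 / Real.log t ^ 2 / ‖x‖ ^ 2) :=
    integral_mono_of_nonneg (ae_of_all _ fun x => by positivity)
      (integrableOn_logAnnulus_const_add_div_sq _ _ ht0)
      ((ae_restrict_mem (measurableSet_logAnnulus t)).mono fun x hx =>
        norm_gradient_mul_logCutoff_sq_le hK ht0 ht1 hx (hφ x hx).1 (hφ x hx).2.1 (hφ x hx).2.2)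
  refine hmono.trans ?_
  rw [setIntegral_logAnnulus_const_add_div_sq _ _ ht0 ht1]
  obtain ⟨L, hL⟩ : ∃ L, Real.log t = -L := ⟨-Real.log t, by ring⟩
  have hLpos : 0 < L := by linarith [Real.log_neg ht0 ht1]
  have htL : t * L ≤ 1 := by
    have h := Real.one_sub_inv_le_log_of_pos ht0
    have h' := mul_le_mul_of_nonneg_left h ht0.le
    rw [mul_sub, mul_inv_cancel₀ ht0.ne', hL] at h'
    linarith
  have hsmall : 2 * (t ^ 2 - t ^ 4) * L ≤ 1 := by
    have : 0 ≤ t ^ 4 * L := by positivity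
    nlinarith
  rw [hL, abs_neg, abs_of_pos hLpos, le_div_iff₀ hLpos]
  have hpiK : 0 ≤ Real.pi * K ^ 2 := by positivity
  calc _ = Real.pi * K ^ 2 * (2 * (t ^ 2 - t ^ 4) * L + 4) := by
        field_simp
        ring
    _ ≤ Real.pi * K ^ 2 * (1 + 4) := by gcongr
    _ = _ := by ring
end

section
/- Let Q = [−1,1] × [−1,1] ⊂ ℝ², and let U ⊆ Q be open in the subspace topology of Q. If there is no continuous path γ : [0,1] → U with γ(0) in the left edge {−1} × [−1,1] and γ(1) in the right edge {1} × [−1,1], then there exists a compact connected subset C of the complement Q ∖ U such that C meets both the bottom edge [−1,1] × {−1} and the top edge [−1,1] × {1}. -/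
open Set Filter Topology

/-- Every continuous map from a simply connected, locally path connected space to the circle
`ℝ ⧸ ℤ` lifts to a real-valued continuous map. -/
lemma exists_continuousMap_lift_addCircle {X : Type*} [TopologicalSpace X]
    [SimplyConnectedSpace X] [LocallyPathConnectedSpace X] (f : C(X, AddCircle (1 : ℝ))) :
    ∃ h : C(X, ℝ), ∀ x, (h x : AddCircle (1 : ℝ)) = f x := by
  obtain ⟨a⟩ : Nonempty X := inferInstance
  obtain ⟨e, he⟩ := QuotientAddGroup.mk_surjective (f a)
  obtain ⟨h, ⟨-, hh⟩, -⟩ :=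
    (AddCircle.isCoveringMap_coe (1 : ℝ)).existsUnique_continuousMap_lifts f a e he
  exact ⟨h, congr_fun hh⟩

/-- Two continuous real functions that agree modulo `ℤ` on a preconnected set differ there by a
constant. -/
lemma IsPreconnected.sub_eq_sub_of_coe_addCircle_eq {X : Type*} [TopologicalSpace X] {S : Set X}
    (hS : IsPreconnected S) {f g : X → ℝ} (hf : ContinuousOn f S) (hg : ContinuousOn g S)
    (hfg : ∀ x ∈ S, (f x : AddCircle (1 : ℝ)) = g x) {x y : X} (hx : x ∈ S) (hy : y ∈ S) :
    f x - g x = f y - g y := by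
  have : DiscreteTopology (range ((↑) : ℤ → ℝ)) :=
    Int.isClosedEmbedding_coe_real.isEmbedding.toHomeomorph.symm.isEmbedding.discreteTopology
  refine hS.constant_of_mapsTo (T := range ((↑) : ℤ → ℝ)) ⟨this⟩ (hf.sub hg) (fun z hz => ?_) hx hy
  have h0 : ((f z - g z : ℝ) : AddCircle (1 : ℝ)) = 0 := by
    rw [AddCircle.coe_sub, hfg z hz, sub_self]
  obtain ⟨n, hn⟩ := AddCircle.coe_eq_zero_iff (1 : ℝ) |>.1 h0
  exact ⟨n, by simpa using hn⟩

/-- The connected components of a compact set are compact. -/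
lemma IsCompact.isCompact_connectedComponentIn {X : Type*} [TopologicalSpace X] {K : Set X}
    (hK : IsCompact K) (x : X) : IsCompact (connectedComponentIn K x) := by
  by_cases hx : x ∈ K
  · have : CompactSpace K := isCompact_iff_compactSpace.1 hK
    rw [connectedComponentIn_eq_image hx]
    exact isClosed_connectedComponent.isCompact.image continuous_subtype_val
  · rw [connectedComponentIn_eq_empty hx]
    exact isCompact_empty

/-- If no connected component of a compact set `K` meets both closed sets `P` and `T`, then `K`
splits into two disjoint closed pieces, one containing `K ∩ P` and the other `K ∩ T`. -/
lemma IsCompact.exists_isClosed_partition_of_connectedComponentIn {X : Type*} [TopologicalSpace X]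
    [T2Space X] {K P T : Set X} (hK : IsCompact K) (hP : IsClosed P) (hT : IsClosed T)
    (h : ∀ x ∈ K ∩ P, Disjoint (connectedComponentIn K x) T) :
    ∃ A B : Set X, IsClosed A ∧ IsClosed B ∧ Disjoint A B ∧ A ∪ B = K ∧
      K ∩ P ⊆ A ∧ K ∩ T ⊆ B := by
  have : CompactSpace K := isCompact_iff_compactSpace.1 hK
  let p : K → ConnectedComponents K := (↑)
  have hp : Continuous p := ConnectedComponents.continuous_coe
  have hP' : IsClosed (p '' ((↑) ⁻¹' P)) :=
    ((hP.preimage continuous_subtype_val).isCompact.image hp).isClosed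
  have hT' : IsClosed (p '' ((↑) ⁻¹' T)) :=
    ((hT.preimage continuous_subtype_val).isCompact.image hp).isClosed
  have hPT : p '' ((↑) ⁻¹' P) ⊆ (p '' ((↑) ⁻¹' T))ᶜ := by
    rintro _ ⟨x, hx, rfl⟩ ⟨y, hy, hxy⟩
    refine disjoint_left.1 (h x ⟨x.2, hx⟩) (?_ : (y : X) ∈ _) hy
    rw [connectedComponentIn_eq_image x.2]
    exact ⟨y, ConnectedComponents.coe_eq_coe'.1 hxy, rfl⟩
  obtain ⟨D, hD, hPD, hDT⟩ := exists_clopen_of_closed_subset_open hP' hT'.isOpen_compl hPT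
  have hD' : IsClopen (p ⁻¹' D) := hD.preimage hp
  refine ⟨(↑) '' (p ⁻¹' D), (↑) '' (p ⁻¹' D)ᶜ,
    (hD'.isClosed.isCompact.image continuous_subtype_val).isClosed,
    (hD'.compl.isClosed.isCompact.image continuous_subtype_val).isClosed,
    (disjoint_image_iff Subtype.val_injective).2 disjoint_compl_right, ?_, ?_, ?_⟩
  · rw [← image_union, union_compl_self, image_univ, Subtype.range_coe]
  · exact fun x hx => ⟨⟨x, hx.1⟩, hPD ⟨⟨x, hx.1⟩, hx.2, rfl⟩, rfl⟩
  · exact fun x hx => ⟨⟨x, hx.1⟩, fun hxD => hDT hxD ⟨⟨x, hx.1⟩, hx.2, rfl⟩, rfl⟩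

/-- In a relatively open subset of a convex set, every point is joined to all nearby points. -/
lemma Convex.eventually_joinedIn {E : Type*} [NormedAddCommGroup E] [NormedSpace ℝ E]
    {Q V : Set E} (hQ : Convex ℝ Q) (hV : IsOpen V) {x : E} (hx : x ∈ V ∩ Q) :
    ∀ᶠ y in 𝓝[Q] x, JoinedIn (V ∩ Q) x y := by
  obtain ⟨r, hr, hrV⟩ := Metric.isOpen_iff.1 hV x hx.1
  filter_upwards [self_mem_nhdsWithin, nhdsWithin_le_nhds (Metric.ball_mem_nhds x hr)] with y hyQ hy
  exact .of_segment_subset <|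
    (((convex_ball x r).inter hQ).segment_subset ⟨Metric.mem_ball_self hr, hx.2⟩ ⟨hy, hyQ⟩).trans
      (inter_subset_inter_left Q hrV)

open Classical in
/-- If `φ` is an integer on the part of `Q` where neither `W` nor `Q \ W` is a relative
neighbourhood, then `φ` modulo `ℤ` can be replaced by `0` off `W` without losing continuity. -/
lemma continuousOn_ite_coe_addCircle {X : Type*} [TopologicalSpace X] {Q W : Set X} {φ : X → ℝ}
    (hφ : Continuous φ)
    (h : ∀ x ∈ Q, W ∈ 𝓝[Q] x ∨ Wᶜ ∈ 𝓝[Q] x ∨ (φ x : AddCircle (1 : ℝ)) = 0) :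
    ContinuousOn (fun x => if x ∈ W then (φ x : AddCircle (1 : ℝ)) else 0) Q := by
  have hφ' : Continuous fun x => (φ x : AddCircle (1 : ℝ)) :=
    (AddCircle.continuous_mk' 1).comp hφ
  intro x hx
  rcases h x hx with hW | hW | h0
  · refine hφ'.continuousWithinAt.congr_of_eventuallyEq_of_mem ?_ hx
    filter_upwards [hW] with y hy using if_pos hy
  · refine continuousWithinAt_const.congr_of_eventuallyEq_of_mem (f := fun _ => 0) ?_ hx
    filter_upwards [hW] with y hy using if_neg hy
  · have hval : (if x ∈ W then (φ x : AddCircle (1 : ℝ)) else 0) = 0 := by simp [h0]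
    have hlim : Tendsto (fun y => (φ y : AddCircle (1 : ℝ))) (𝓝[Q] x) (𝓝 0) :=
      h0 ▸ hφ'.continuousWithinAt
    rw [ContinuousWithinAt, hval]
    exact (hlim.mono_left inf_le_left).if (tendsto_const_nhds.mono_left inf_le_left)

/-- A continuous function on the square with values in `ℝ ⧸ ℤ` lifts to `ℝ`. -/
lemma ContinuousOn.exists_lift_addCircle_square {G : ℝ × ℝ → AddCircle (1 : ℝ)}
    (hG : ContinuousOn G (Icc (-1, -1) (1, 1))) :
    ∃ h : ℝ × ℝ → ℝ, Continuous h ∧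
      ∀ x ∈ Icc ((-1, -1) : ℝ × ℝ) (1, 1), (h x : AddCircle (1 : ℝ)) = G x := by
  let r : ℝ × ℝ → ℝ × ℝ := fun x => (-1, -1) ⊔ ((1, 1) ⊓ x)
  have hr : Continuous r := by
    change Continuous fun x : ℝ × ℝ => (max (-1) (min 1 x.1), max (-1) (min 1 x.2))
    fun_prop
  have hrQ : ∀ x, r x ∈ Icc ((-1, -1) : ℝ × ℝ) (1, 1) := fun x =>
    ⟨le_sup_left, sup_le (by constructor <;> norm_num) inf_le_left⟩
  obtain ⟨h, hh⟩ := exists_continuousMap_lift_addCircle ⟨_, hG.comp_continuous hr hrQ⟩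
  refine ⟨h, h.continuous, fun x hx => ?_⟩
  rw [hh x]
  change G (r x) = G x
  rw [show r x = x by simp only [r]; rw [inf_eq_right.2 hx.2, sup_eq_right.2 hx.1]]

theorem crossing_duality_in_square (U : Set (ℝ × ℝ))
    (hUQ : U ⊆ Set.Icc (-1, -1) (1, 1))
    (hUopen : ∃ V : Set (ℝ × ℝ), IsOpen V ∧ U = V ∩ Set.Icc (-1, -1) (1, 1))
    (hnopath : ¬ ∃ γ : ℝ → ℝ × ℝ, ContinuousOn γ (Set.Icc 0 1) ∧
      (∀ s ∈ Set.Icc (0 : ℝ) 1, γ s ∈ U) ∧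
      γ 0 ∈ ({-1} : Set ℝ) ×ˢ Set.Icc (-1 : ℝ) 1 ∧
      γ 1 ∈ ({1} : Set ℝ) ×ˢ Set.Icc (-1 : ℝ) 1) :
    ∃ C : Set (ℝ × ℝ), IsCompact C ∧ IsConnected C ∧
      C ⊆ Set.Icc (-1, -1) (1, 1) \ U ∧
      (C ∩ Set.Icc (-1 : ℝ) 1 ×ˢ ({-1} : Set ℝ)).Nonempty ∧
      (C ∩ Set.Icc (-1 : ℝ) 1 ×ˢ ({1} : Set ℝ)).Nonempty := by
  obtain ⟨V, hV, rfl⟩ := hUopen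
  set Q : Set (ℝ × ℝ) := Icc (-1, -1) (1, 1) with hQdef
  have hQ_iff : ∀ x y : ℝ, (x, y) ∈ Q ↔ x ∈ Icc (-1) 1 ∧ y ∈ Icc (-1) 1 := fun x y => by
    simp only [hQdef, mem_Icc, Prod.mk_le_mk]; tauto
  have hQ : Convex ℝ Q := convex_Icc _ _
  have hK : IsCompact (Q \ (V ∩ Q)) := by
    rw [sdiff_inter_self_eq_sdiff]
    exact isCompact_Icc.diff hV
  have hclosed : ∀ a : ℝ, IsClosed (Icc (-1 : ℝ) 1 ×ˢ {a}) := fun a =>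
    isClosed_Icc.prod isClosed_singleton
  by_contra hC
  obtain ⟨A, B, hA, hB, hAB, hABK, hbot, htop⟩ :=
    hK.exists_isClosed_partition_of_connectedComponentIn (hclosed (-1)) (hclosed 1)
      fun x hx => by
        rw [disjoint_iff_inter_eq_empty, ← not_nonempty_iff_eq_empty]
        refine fun hmeet => hC ⟨connectedComponentIn (Q \ (V ∩ Q)) x,
          hK.isCompact_connectedComponentIn x, isConnected_connectedComponentIn_iff.2 hx.1,
          connectedComponentIn_subset _ _,
          ⟨x, mem_connectedComponentIn hx.1, hx.2⟩, hmeet⟩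
  have hAK : A ⊆ Q \ (V ∩ Q) := hABK ▸ subset_union_left
  have hBK : B ⊆ Q \ (V ∩ Q) := hABK ▸ subset_union_right
  have hdisj : Disjoint (A ∪ Icc (-1 : ℝ) 1 ×ˢ {-1}) (B ∪ Icc (-1 : ℝ) 1 ×ˢ {1}) := by
    rw [disjoint_left] at hAB ⊢
    rintro x (hxA | hxb) (hxB | hxt)
    · exact hAB hxA hxB
    · exact hAB hxA (htop ⟨hAK hxA, hxt⟩)
    · exact hAB (hbot ⟨hBK hxB, hxb⟩) hxB
    · have h1 : x.2 = -1 := hxb.2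
      have h2 : x.2 = 1 := hxt.2
      linarith
  obtain ⟨φ, hφ0, hφ1, -⟩ := exists_continuous_zero_one_of_isClosed
    (hA.union (hclosed (-1))) (hB.union (hclosed 1)) hdisj
  have hcoe1 : ((1 : ℝ) : AddCircle (1 : ℝ)) = 0 := AddCircle.coe_period 1
  have hφK : ∀ x ∈ Q \ (V ∩ Q), (φ x : AddCircle (1 : ℝ)) = 0 := by
    intro x hx
    rw [← hABK] at hx
    rcases hx with hx | hx
    · simp [hφ0 (Or.inl hx)]
    · simp [hφ1 (Or.inl hx), hcoe1]
  let W : Set (ℝ × ℝ) := {x | ∃ s ∈ ({-1} : Set ℝ) ×ˢ Icc (-1 : ℝ) 1, JoinedIn (V ∩ Q) s x}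
  have hW : ∀ x ∈ Q, W ∈ 𝓝[Q] x ∨ Wᶜ ∈ 𝓝[Q] x ∨ (φ x : AddCircle (1 : ℝ)) = 0 := by
    intro x hx
    by_cases hxV : x ∈ V
    · have hnear := hQ.eventually_joinedIn hV ⟨hxV, hx⟩
      by_cases hxW : x ∈ W
      · obtain ⟨s, hs, hsx⟩ := hxW
        exact .inl <| hnear.mono fun y hy => ⟨s, hs, hsx.trans hy⟩
      · refine .inr <| .inl <| hnear.mono fun y hy ⟨s, hs, hsy⟩ => hxW ⟨s, hs, hsy.trans hy.symm⟩
    · exact .inr <| .inr <| hφK x ⟨hx, fun h => hxV h.1⟩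
  obtain ⟨h, hh, hhG⟩ :=
    (continuousOn_ite_coe_addCircle φ.continuous hW).exists_lift_addCircle_square
  have hleft : ∀ x ∈ ({-1} : Set ℝ) ×ˢ Icc (-1 : ℝ) 1, (h x : AddCircle (1 : ℝ)) = φ x := by
    rintro ⟨x, y⟩ ⟨rfl : x = -1, hy⟩
    have hxQ : ((-1 : ℝ), y) ∈ Q := (hQ_iff _ _).2 ⟨by norm_num, hy⟩
    rw [hhG _ hxQ]
    split_ifs with hxW
    · rfl
    · refine (hφK _ ⟨hxQ, fun hxU => hxW ⟨(-1, y), ⟨rfl, hy⟩, JoinedIn.refl hxU⟩⟩).symm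
  have hright : ∀ x ∈ ({1} : Set ℝ) ×ˢ Icc (-1 : ℝ) 1,
      (h x : AddCircle (1 : ℝ)) = (0 : ℝ) := by
    rintro ⟨x, y⟩ ⟨rfl : x = 1, hy⟩
    rw [hhG _ ((hQ_iff _ _).2 ⟨by norm_num, hy⟩), if_neg, AddCircle.coe_zero]
    rintro ⟨s, hs, γ, hγ⟩
    refine hnopath ⟨γ.extend, γ.continuous_extend.continuousOn, fun t ht => ?_, ?_, ?_⟩
    · rw [γ.extend_apply ht]
      exact hγ _
    · rwa [γ.extend_zero]
    · rw [γ.extend_one]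
      exact ⟨rfl, hy⟩
  have hhoriz : ∀ a ∈ Icc (-1 : ℝ) 1,
      (∀ x ∈ Icc (-1 : ℝ) 1 ×ˢ {a}, (φ x : AddCircle (1 : ℝ)) = 0) →
      ∀ x ∈ Icc (-1 : ℝ) 1 ×ˢ {a}, (h x : AddCircle (1 : ℝ)) = (0 : ℝ) := by
    rintro a ha hφa ⟨x, y⟩ ⟨hx, rfl : y = a⟩
    rw [hhG _ ((hQ_iff _ _).2 ⟨hx, ha⟩), hφa _ ⟨hx, rfl⟩, ite_self, AddCircle.coe_zero]
  have hbottom := hhoriz (-1) (by norm_num) fun x hx => by simp [hφ0 (Or.inr hx)]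
  have htop' := hhoriz 1 (by norm_num) fun x hx => by simp [hφ1 (Or.inr hx), hcoe1]
  have hI : IsPreconnected (Icc (-1 : ℝ) 1) := isPreconnected_Icc
  have h1 : (1 : ℝ) ∈ Icc (-1 : ℝ) 1 := by norm_num
  have h1' : (-1 : ℝ) ∈ Icc (-1 : ℝ) 1 := by norm_num
  have el := (isPreconnected_singleton.prod hI).sub_eq_sub_of_coe_addCircle_eq
    hh.continuousOn φ.continuous.continuousOn hleft
    (x := (-1, -1)) (y := (-1, 1)) ⟨rfl, h1'⟩ ⟨rfl, h1⟩
  have er := (isPreconnected_singleton.prod hI).sub_eq_sub_of_coe_addCircle_eq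
    hh.continuousOn continuousOn_const hright
    (x := (1, -1)) (y := (1, 1)) ⟨rfl, h1'⟩ ⟨rfl, h1⟩
  have eb := (hI.prod isPreconnected_singleton).sub_eq_sub_of_coe_addCircle_eq
    hh.continuousOn continuousOn_const hbottom
    (x := (-1, -1)) (y := (1, -1)) ⟨h1', rfl⟩ ⟨h1, rfl⟩
  have et := (hI.prod isPreconnected_singleton).sub_eq_sub_of_coe_addCircle_eq
    hh.continuousOn continuousOn_const htop'
    (x := (-1, 1)) (y := (1, 1)) ⟨h1', rfl⟩ ⟨h1, rfl⟩
  have φb : φ (-1, -1) = 0 := hφ0 (Or.inr ⟨h1', rfl⟩)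
  have φt : φ (-1, 1) = 1 := hφ1 (Or.inr ⟨h1', rfl⟩)
  linarith
end
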